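/- Let X ⊂ int(𝔸) be an f-invariant essential annular continuum. Assume there exists ρ < 0 such that for all points x, y ∈ X̃ accessible from Ũ₊ one has k(f̃ⁿ(x), y)/n → ρ as n → ∞, assume inf ρ_mes(f̃, X) > 0, and assume (f̃(x))₁ ≥ (x)₁ + 1 for every x ∈ X̃. If (V)₁ is unbounded from below, then (V)₁ is also unbounded from above, i.e. sup (V)₁ = +∞. -/

import Mathlib

open Set Function MeasureTheory Filter Topology

noncomputable section

/-- The vertical fiber `[-1,1]`. -/
abbrev II : Set ℝ := Set.Icc (-1 : ℝ) 1

/-- The universal cover `ℝ × [-1,1]` of the annulus. -/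
abbrev Strip : Type := ℝ × II

/-- The compact annulus `(ℝ/ℤ) × [-1,1]`. -/
abbrev Ann : Type := AddCircle (1 : ℝ) × II

/-- The covering projection `π`. -/
def pr (z : Strip) : Ann := ((z.1 : AddCircle (1 : ℝ)), z.2)

/-- The deck transformation `T^k`. -/
def shiftPt (k : ℤ) (z : Strip) : Strip := (z.1 + k, z.2)

/-- `S + k`, the image of `S` under `T^k`. -/
def shiftSet (k : ℤ) (S : Set Strip) : Set Strip := shiftPt k '' S

/-- `f` is isotopic to the identity. -/
def IsotopicToId (f : Ann → Ann) : Prop :=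
  ∃ H : ℝ → Ann → Ann, Continuous (fun p : ℝ × Ann => H p.1 p.2) ∧
    (∀ t : ℝ, Function.Bijective (H t)) ∧ H 0 = id ∧ H 1 = f

/-- `F` is a lift of `f` commuting with the deck transformation. -/
def IsLift (f : Ann → Ann) (F : Strip → Strip) : Prop :=
  (∀ z, pr (F z) = f (pr z)) ∧ (∀ z, F (shiftPt 1 z) = shiftPt 1 (F z))

/-- `X` is an essential annular continuum with complementary components `Um`, `Up`. -/
structure IsEAC (X Um Up : Set Ann) : Prop where
  compact : IsCompact X
  connected : IsConnected X
  inInterior : ∀ p ∈ X, ((p.2 : ℝ)) ∈ Set.Ioo (-1 : ℝ) 1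
  hUm : Um = connectedComponentIn Xᶜ ((0 : AddCircle (1 : ℝ)), ⟨-1, le_rfl, by norm_num⟩)
  hUp : Up = connectedComponentIn Xᶜ ((0 : AddCircle (1 : ℝ)), ⟨1, by norm_num, le_rfl⟩)
  cover : Xᶜ = Um ∪ Up
  ne : Um ≠ Up

/-- An arc `γ : [0,1] → U ∪ {p}` with `γ([0,1)) ⊂ U` and `γ(1) = p`. -/
def IsArcTo (U : Set Strip) (γ : unitInterval → Strip) (p : Strip) : Prop :=
  Continuous γ ∧ Function.Injective γ ∧ (∀ t, t ≠ 1 → γ t ∈ U) ∧ γ 1 = p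

/-- `p` is accessible from `U`. -/
def AccFrom (U : Set Strip) (p : Strip) : Prop := ∃ γ, IsArcTo U γ p

/-- The order `≺` on accessible points, with access arcs starting on `ℝ × {b}`. -/
def PrecB (b : ℝ) (U : Set Strip) (x x' : Strip) : Prop :=
  ∃ γ γ' : unitInterval → Strip,
    IsArcTo U γ x ∧ IsArcTo U γ' x' ∧
    ((γ 0).2 : ℝ) = b ∧ ((γ' 0).2 : ℝ) = b ∧
    Disjoint (range γ) (range γ') ∧ (γ 0).1 < (γ' 0).1

/-- `k = k(x,y)` is the unique integer with `T^k(y) ⪯ x ≺ T^{k+1}(y)`. -/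
def AccIdxB (b : ℝ) (U : Set Strip) (x y : Strip) (k : ℤ) : Prop :=
  (shiftPt k y = x ∨ PrecB b U (shiftPt k y) x) ∧ PrecB b U x (shiftPt (k + 1) y)

/-- `ρ` is the prime end rotation number of the lift `F` as seen from `U`
(access arcs starting at height `b`): `k(Fⁿ(x), y)/n → ρ` for all accessible `x, y`. -/
def PrimeEndRotB (b : ℝ) (U Xt : Set Strip) (F : Strip → Strip) (ρ : ℝ) : Prop :=
  ∀ x ∈ Xt, ∀ y ∈ Xt, AccFrom U x → AccFrom U y →
    ∀ k : ℕ → ℤ, (∀ n : ℕ, AccIdxB b U (F^[n] x) y (k n)) →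
      Tendsto (fun n : ℕ => (k n : ℝ) / (n : ℝ)) atTop (𝓝 ρ)

/-- The measure-theoretic rotation set `ρ_mes(g̃, X)`, where `φ` is the displacement
function of the lift `g̃` (pushed down to the annulus). -/
def rotMes (g : Ann → Ann) (φ : Ann → ℝ) (X : Set Ann) : Set ℝ :=
  {r | ∃ μ : Measure Ann, IsProbabilityMeasure μ ∧ Measure.map g μ = μ ∧
    μ Xᶜ = 0 ∧ ∫ a, φ a ∂μ = r}

/-- A point in the interior of the top boundary segment `(0,1) × {1}`. -/
def topSeg : Strip := ((1 : ℝ) / 2, ⟨1, by norm_num, le_rfl⟩)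

/-- `β' = β ∖ {x₀} = {0} × (η, 1]`. -/
def betaP (η : ℝ) : Set Strip := {z : Strip | z.1 = 0 ∧ η < (z.2 : ℝ)}

/-- `η = max{y : (0,y) ∈ X̃}`. -/
def etaSpec (Xt : Set Strip) (η : ℝ) : Prop :=
  IsGreatest {y : ℝ | ∃ z ∈ Xt, z.1 = 0 ∧ (z.2 : ℝ) = y} η

/-- The fundamental region `V`: the closure, relative to `Ũ₊`, of the connected
component of `Ũ₊ ∖ (β' ∪ (β' + 1))` containing the segment `(0,1) × {1}`. -/
def Vset (Utp : Set Strip) (η : ℝ) : Set Strip :=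
  Utp ∩ closure (connectedComponentIn (Utp \ (betaP η ∪ shiftSet 1 (betaP η))) topSeg)

/-- A hair of `W`: an arc in `W` starting on `ℝ × {1}`. -/
def IsHair (W : Set Strip) (γ : unitInterval → Strip) : Prop :=
  Continuous γ ∧ Function.Injective γ ∧ ((γ 0).2 : ℝ) = 1 ∧ ∀ t, γ t ∈ W

/-- `(γ)₁`, the projection of the image of `γ` to the first coordinate. -/
def proj1 (γ : unitInterval → Strip) : Set ℝ := range fun t => (γ t).1

/-- `(V + k)⁻ = ⋃_{j ≤ k} (V + j)`. -/
def VMinus (k : ℤ) (V : Set Strip) : Set Strip := ⋃ j ∈ Iic k, shiftSet j V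

/-- `(V + k)⁺ = ⋃_{j ≥ k} (V + j)`. -/
def VPlus (k : ℤ) (V : Set Strip) : Set Strip := ⋃ j ∈ Ici k, shiftSet j V

/-- A crosscut of `Ũ₊`: an arc with endpoints on `X̃` and interior in `Ũ₊`. -/
def IsCrosscut (Utp Xt : Set Strip) (c : unitInterval → Strip) : Prop :=
  Continuous c ∧ Function.Injective c ∧ c 0 ∈ Xt ∧ c 1 ∈ Xt ∧
    ∀ t, t ≠ 0 → t ≠ 1 → c t ∈ Utp

/-- `F^n` for `n : ℤ`. -/
def iterZ (F : Strip ≃ₜ Strip) (n : ℤ) : Strip → Strip := fun z => (F.toEquiv ^ n) z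

end


/-! ### Part 1: invariance of the boundary and preservation of the upper component -/

instance instLPC_II : LocallyPathConnectedSpace II :=
  (isQuotientMap_projIcc (h := (by norm_num : (-1 : ℝ) ≤ 1))).locallyPathConnectedSpace

theorem pr_isOpenQuotientMap : IsOpenQuotientMap pr := by
  have h1 : IsOpenQuotientMap (fun x : ℝ => (x : AddCircle (1 : ℝ))) :=
    QuotientAddGroup.isOpenQuotientMap_mk
  exact h1.prodMap (IsOpenQuotientMap.id (X := II))

theorem pr_cont : Continuous pr := pr_isOpenQuotientMap.continuous

instance instLPC_Ann : LocallyPathConnectedSpace Ann :=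
  pr_isOpenQuotientMap.isQuotientMap.locallyPathConnectedSpace

theorem no_null_homotopy (G : ℝ × ℝ → ℂ) (hG : Continuous G) (h0 : ∀ p, G p ≠ 0)
    (hper : ∀ u, G (u, 0) = G (u, 1)) (r : ℝ) (hr : 0 < r)
    (h1 : ∀ θ, G (1, θ) = r * Complex.exp (2 * Real.pi * θ * Complex.I))
    (c : ℂ) (hc : ∀ θ, G (0, θ) = c) : False := by
  obtain ⟨L, ⟨-, hL⟩, -⟩ := Complex.isCoveringMapOn_exp.existsUnique_continuousMap_lifts
    (⟨G, hG⟩ : C(ℝ × ℝ, ℂ)) (a₀ := (0, 0)) (e₀ := Complex.log (G (0, 0)))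
    (Complex.exp_log (h0 _)) (fun p => h0 p)
  have hL' : ∀ p, Complex.exp (L p) = G p := fun p => congrFun hL p
  have twopi : (2 * Real.pi * Complex.I : ℂ) ≠ 0 := by
    simp [Real.pi_ne_zero]
  -- a continuous function with values in `2πiℤ` is constant
  have key : ∀ g : ℝ → ℂ, Continuous g → (∀ x, Complex.exp (g x) = 1) → ∀ x y, g x = g y := by
    intro g hg h1 x y
    have hd : ∀ x, ∃ n : ℤ, g x = n * (2 * Real.pi * Complex.I) := fun x => by
      obtain ⟨n, hn⟩ := Complex.exp_eq_one_iff.1 (h1 x)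
      exact ⟨n, hn⟩
    choose n hn using hd
    have hcont : Continuous (fun x => ((n x : ℤ) : ℂ)) := by
      have : (fun x => ((n x : ℤ) : ℂ)) = fun x => g x / (2 * Real.pi * Complex.I) := by
        funext x; rw [hn x]; field_simp
      rw [this]; exact hg.div_const _
    have hcont' : Continuous n := by
      have hc2 : Continuous (fun x => ((n x : ℤ) : ℝ)) := by
        have := Complex.continuous_re.comp hcont
        simpa [Function.comp_def] using this
      exact Int.isClosedEmbedding_coe_real.isEmbedding.continuous_iff.2 hc2
    have := PreconnectedSpace.constant (inferInstance : PreconnectedSpace ℝ) hcont' (x := x) (y := y)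
    rw [hn, hn, this]
  have k1 := key (fun u => L (u, 1) - L (u, 0)) (by fun_prop) (by
    intro u
    rw [Complex.exp_sub, hL', hL', hper, div_self (h0 _)]) 0 1
  have k2 := key (fun θ => L (0, θ) - L (0, 0)) (by fun_prop) (by
    intro u
    rw [Complex.exp_sub, hL', hL', hc, hc, div_self (by rw [← hc 0]; exact h0 _)]) 0 1
  have k3 := key (fun θ => L (1, θ) - 2 * Real.pi * θ * Complex.I - L (1, 0)) (by fun_prop) (by
    intro u
    have hr' : (r : ℂ) ≠ 0 := by exact_mod_cast hr.ne'
    rw [Complex.exp_sub, Complex.exp_sub, hL', hL', h1, h1]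
    have := Complex.exp_ne_zero (2 * Real.pi * u * Complex.I)
    simp only [Complex.ofReal_zero, mul_zero, zero_mul, Complex.exp_zero, mul_one]
    field_simp) 0 1
  simp only [Complex.ofReal_zero, Complex.ofReal_one, mul_zero, zero_mul, mul_one] at k1 k2 k3
  apply twopi
  linear_combination k3 - k1 - k2

/-- Planar embedding of the annulus. -/
noncomputable def emb (a : Ann) : ℂ := (AddCircle.toCircle a.1 : ℂ) * ((2 + (a.2 : ℝ) : ℝ) : ℂ)

theorem emb_cont : Continuous emb := by
  unfold emb
  have h1 : Continuous (fun a : Ann => AddCircle.toCircle a.1) :=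
    AddCircle.continuous_toCircle.comp continuous_fst
  have h2 : Continuous (fun a : Ann => ((2 + (a.2 : ℝ) : ℝ) : ℂ)) := by fun_prop
  exact (continuous_subtype_val.comp h1).mul h2

theorem emb_inj : Function.Injective emb := by
  rintro ⟨a, s⟩ ⟨b, t⟩ h
  unfold emb at h
  have hs : (0 : ℝ) < 2 + s := by have := s.2.1; linarith
  have ht : (0 : ℝ) < 2 + t := by have := t.2.1; linarith
  have h2 := congrArg norm h
  simp only [norm_mul, Circle.norm_coe, one_mul, Complex.norm_real, Real.norm_eq_abs,
    abs_of_pos hs, abs_of_pos ht] at h2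
  have hst : s = t := Subtype.ext (by linarith)
  subst hst
  have h3 : (AddCircle.toCircle a : ℂ) = AddCircle.toCircle b :=
    mul_right_cancel₀ (by exact_mod_cast hs.ne') h
  have := AddCircle.injective_toCircle one_ne_zero (Subtype.ext h3)
  exact Prod.ext this rfl

theorem emb_image_nhds (q : Ann) (hq : (q.2 : ℝ) ∈ Set.Ioo (-1 : ℝ) 1) (A : Set Ann)
    (hA : A ∈ 𝓝 q) : emb '' A ∈ 𝓝 (emb q) := by
  obtain ⟨z, rfl⟩ := pr_isOpenQuotientMap.surjective q
  have hN : pr ⁻¹' A ∈ 𝓝 z := pr_cont.continuousAt.preimage_mem_nhds hA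
  let j : Strip → ℂ := fun z => ⟨Real.log (2 + (z.2 : ℝ)), 2 * Real.pi * z.1⟩
  let k : ℂ → Strip := fun w => (w.im / (2 * Real.pi),
    Set.projIcc (-1 : ℝ) 1 (by norm_num) (Real.exp w.re - 2))
  have hk : Continuous k := by
    refine Continuous.prodMk (by fun_prop) (continuous_projIcc.comp (by fun_prop))
  have hpos : ∀ z : Strip, (0 : ℝ) < 2 + (z.2 : ℝ) := fun z => by have := z.2.2.1; linarith
  have hpi := Real.pi_pos
  have hkj : ∀ z, k (j z) = z := by
    intro z
    apply Prod.ext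
    · simp only [k, j]; field_simp
    · simp only [k, j, Real.exp_log (hpos z), add_sub_cancel_left]
      exact Set.projIcc_val _ z.2
  have hjk : ∀ w : ℂ, Real.exp w.re - 2 ∈ Set.Ioo (-1 : ℝ) 1 → j (k w) = w := by
    intro w hw
    simp only [j, k, Set.projIcc_of_mem _ (Set.Ioo_subset_Icc_self hw)]
    apply Complex.ext
    · simp
    · simp only; field_simp
  have hexp : ∀ z, Complex.exp (j z) = emb (pr z) := by
    intro z
    have : j z = (Real.log (2 + (z.2 : ℝ)) : ℂ) + ((2 * Real.pi * z.1 : ℝ) : ℂ) * Complex.I := by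
      apply Complex.ext <;> simp [j]
    rw [this, Complex.exp_add, ← Complex.ofReal_exp, Real.exp_log (hpos z)]
    simp only [emb, pr, AddCircle.toCircle_apply_mk, div_one, Circle.coe_exp]
    ring
  have hj : j '' (pr ⁻¹' A) ∈ 𝓝 (j z) := by
    have h1 : k ⁻¹' (pr ⁻¹' A) ∈ 𝓝 (j z) := hk.continuousAt.preimage_mem_nhds (by rwa [hkj])
    have hc : Continuous (fun w : ℂ => Real.exp w.re - 2) := by fun_prop
    have h2 : (fun w : ℂ => Real.exp w.re - 2) ⁻¹' Set.Ioo (-1 : ℝ) 1 ∈ 𝓝 (j z) := by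
      apply hc.continuousAt.preimage_mem_nhds
      apply isOpen_Ioo.mem_nhds
      simp only [j, Real.exp_log (hpos z), add_sub_cancel_left]
      exact hq
    filter_upwards [h1, h2] with w hw1 hw2
    exact ⟨k w, hw1, hjk w hw2⟩
  have := Complex.isOpenMap_exp.image_mem_nhds hj
  rw [hexp] at this
  refine Filter.mem_of_superset this ?_
  rintro _ ⟨_, ⟨w, hw, rfl⟩, rfl⟩
  exact ⟨pr w, hw, (hexp w).symm⟩

theorem pr_inj_small {z w : Strip} (hz : |z.1| ≤ 1 / 4) (hw : |w.1| ≤ 1 / 4) (h : pr z = pr w) :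
    z = w := by
  have h1 := congrArg Prod.fst h
  have h2 := congrArg Prod.snd h
  simp only [pr] at h1 h2
  have hz' := abs_le.1 hz
  have hw' := abs_le.1 hw
  have : Fact ((0 : ℝ) < 1) := ⟨one_pos⟩
  rw [AddCircle.coe_eq_coe_iff_of_mem_Ico (a := -1 / 2) ⟨by linarith, by linarith⟩
    ⟨by linarith, by linarith⟩] at h1
  exact Prod.ext h1 h2

/-- Top point of the annulus. -/
def topPt : Ann := ((0 : AddCircle (1 : ℝ)), ⟨1, by norm_num, le_rfl⟩)

theorem boundary_invariance (h : Ann → Ann) (hc : Continuous h) (hb : Function.Bijective h) :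
    ((h topPt).2 : ℝ) ∉ Set.Ioo (-1 : ℝ) 1 := by
  intro hq
  let p : Strip := (0, ⟨1, by norm_num, le_rfl⟩)
  have hp : pr p = topPt := rfl
  let hh : Ann ≃ₜ Ann := Continuous.homeoOfEquivCompactToT2 (f := Equiv.ofBijective h hb) hc
  have hopen : IsOpenMap h := hh.isOpenMap
  let ψ : Strip → ℂ := fun z => emb (h (pr z))
  have hψ : Continuous ψ := emb_cont.comp (hc.comp pr_cont)
  let K : Set Strip := {z | |z.1| ≤ 1 / 4}
  have hKeq : K = Set.Icc (-(1 / 4) : ℝ) (1 / 4) ×ˢ (Set.univ : Set II) := by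
    ext z; simp [K, abs_le]
  have hKc : IsCompact K := by
    rw [hKeq]; exact isCompact_Icc.prod isCompact_univ
  have hinj : Set.InjOn ψ K := fun z hz w hw e => pr_inj_small hz hw (hb.1 (emb_inj e))
  have hKn : K ∈ 𝓝 p := by
    have : IsOpen {z : Strip | |z.1| < 1 / 4} := isOpen_lt (by fun_prop) (by fun_prop)
    refine Filter.mem_of_superset (this.mem_nhds (by simp [p])) ?_
    intro z hz; exact le_of_lt (show |z.1| < 1 / 4 from hz)
  have hn : ψ '' K ∈ 𝓝 (ψ p) := by
    have h1 : h '' (pr '' K) ∈ 𝓝 (h (pr p)) :=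
      hopen.image_mem_nhds (pr_isOpenQuotientMap.isOpenMap.image_mem_nhds hKn)
    have h2 := emb_image_nhds (h (pr p)) hq _ h1
    have : ψ '' K = emb '' (h '' (pr '' K)) := by simp only [Set.image_image, ψ]
    rw [this]; exact h2
  obtain ⟨r, hr, hball⟩ := Metric.nhds_basis_closedBall.mem_iff.1 hn
  have : CompactSpace K := isCompact_iff_compactSpace.1 hKc
  have hemb : Topology.IsClosedEmbedding (fun z : K => ψ z) :=
    Continuous.isClosedEmbedding (hψ.comp continuous_subtype_val)
      (fun a b e => Subtype.ext (hinj a.2 b.2 e))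
  let Φ := hemb.isEmbedding.toHomeomorph
  let cir : ℝ → ℂ := fun θ => ψ p + r * Complex.exp (2 * Real.pi * θ * Complex.I)
  have hcir : Continuous cir := by fun_prop
  have hnorm : ∀ θ : ℝ, ‖Complex.exp (2 * Real.pi * θ * Complex.I)‖ = 1 := by
    intro θ
    have := Complex.norm_exp_ofReal_mul_I (2 * Real.pi * θ)
    push_cast at this; exact this
  have hmem : ∀ θ, cir θ ∈ Set.range (fun z : K => ψ z) := by
    intro θ
    have : cir θ ∈ Metric.closedBall (ψ p) r := by
      simp [cir, hnorm, abs_of_pos hr]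
    obtain ⟨z, hz, e⟩ := hball this
    exact ⟨⟨z, hz⟩, e⟩
  let κ : ℝ → K := fun θ => Φ.symm ⟨cir θ, hmem θ⟩
  have hκ : Continuous κ := Φ.symm.continuous.comp (hcir.subtype_mk _)
  have hψκ : ∀ θ, ψ (κ θ) = cir θ := by
    intro θ
    have := congrArg Subtype.val (Φ.apply_symm_apply ⟨cir θ, hmem θ⟩)
    exact this
  let cl : ℝ → ℝ := fun u => max 0 (min u 1)
  have cl0 : ∀ u, 0 ≤ cl u := fun u => le_max_left _ _
  have cl1 : ∀ u, cl u ≤ 1 := fun u => max_le zero_le_one (min_le_right _ _)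
  have hcl : Continuous cl := by fun_prop
  have hy : ∀ (u : ℝ) (z : Strip), cl u * (z.2 : ℝ) ∈ II := by
    intro u z
    have := abs_le.1 (show |cl u * (z.2 : ℝ)| ≤ 1 by
      rw [abs_mul, abs_of_nonneg (cl0 u)]
      exact mul_le_one₀ (cl1 u) (abs_nonneg _) (abs_le.2 z.2.2))
    exact this
  let sc : ℝ × ℝ → Strip := fun q => (cl q.1 * (κ q.2 : Strip).1, ⟨cl q.1 * ((κ q.2 : Strip).2 : ℝ), hy _ _⟩)
  have hsc : Continuous sc := by
    refine Continuous.prodMk ?_ (Continuous.subtype_mk ?_ _) <;> fun_prop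
  have hscK : ∀ q, sc q ∈ K := by
    intro q
    change |cl q.1 * (κ q.2 : Strip).1| ≤ 1 / 4
    rw [abs_mul, abs_of_nonneg (cl0 _)]
    calc _ ≤ 1 * |(κ q.2 : Strip).1| := mul_le_mul_of_nonneg_right (cl1 _) (abs_nonneg _)
      _ ≤ _ := by rw [one_mul]; exact (κ q.2).2
  have hsc1 : ∀ θ, sc (1, θ) = κ θ := by
    intro θ; apply Prod.ext <;> simp [sc, cl]
  have hscp : ∀ q, sc q ≠ p := by
    intro q hqp
    have e2 : cl q.1 * ((κ q.2 : Strip).2 : ℝ) = 1 := congrArg (fun z : Strip => (z.2 : ℝ)) hqp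
    have b1 := (κ q.2 : Strip).2.2.2
    have b2 : cl q.1 = 1 := by
      rcases (cl1 q.1).lt_or_eq with h | h
      · nlinarith [cl0 q.1]
      · exact h
    have : sc q = κ q.2 := by apply Prod.ext <;> simp [sc, b2]
    rw [this] at hqp
    have := hψκ q.2
    rw [hqp] at this
    have h3 : (r : ℂ) * Complex.exp (2 * Real.pi * q.2 * Complex.I) = 0 := by
      have : ψ p = ψ p + r * Complex.exp (2 * Real.pi * q.2 * Complex.I) := this
      linear_combination -this
    rcases mul_eq_zero.1 h3 with h | h
    · exact hr.ne' (by exact_mod_cast h)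
    · exact Complex.exp_ne_zero _ h
  have hp' : p ∈ K := by simp [p, K]
  refine no_null_homotopy (fun q => ψ (sc q) - ψ p) (by fun_prop) ?_ ?_ r hr ?_
    (ψ (0, ⟨0, by norm_num, by norm_num⟩) - ψ p) ?_
  · intro q h0
    exact hscp q (hinj (hscK q) hp' (sub_eq_zero.1 h0))
  · intro u
    have : κ 0 = κ 1 := by
      apply Subtype.ext
      apply hinj (κ 0).2 (κ 1).2
      rw [hψκ, hψκ]
      simp [cir, Complex.exp_two_pi_mul_I]
    simp only [sc, this]
  · intro θ
    simp only [hsc1, hψκ, cir]; ring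
  · intro θ
    have : sc (0, θ) = (0, ⟨0, by norm_num, by norm_num⟩) := by
      apply Prod.ext <;> simp [sc, cl]
    simp only [this]

theorem isotopic_top (f : Ann → Ann) (hf : IsotopicToId f) : ((f topPt).2 : ℝ) = 1 := by
  obtain ⟨H, hHc, hHb, h0, h1⟩ := hf
  have hcg : Continuous (fun t : ℝ => ((H t topPt).2 : ℝ)) := by
    have : Continuous (fun t : ℝ => H t topPt) :=
      hHc.comp (Continuous.prodMk continuous_id continuous_const)
    fun_prop
  have hni : ∀ t, ((H t topPt).2 : ℝ) ∉ Set.Ioo (-1 : ℝ) 1 := fun t =>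
    boundary_invariance (H t) (hHc.comp (Continuous.prodMk continuous_const continuous_id)) (hHb t)
  by_contra hne
  rw [← h1] at hne
  have hlt : ((H 1 topPt).2 : ℝ) < 1 := lt_of_le_of_ne (H 1 topPt).2.2.2 hne
  have hm1 : ((H 1 topPt).2 : ℝ) ≤ 0 := by
    by_contra hh
    exact hni 1 ⟨by linarith, hlt⟩
  have h00 : ((H 0 topPt).2 : ℝ) = 1 := by rw [h0]; rfl
  have := intermediate_value_Icc' (zero_le_one (α := ℝ)) hcg.continuousOn
  obtain ⟨t, -, ht⟩ := this (show (0 : ℝ) ∈ _ from ⟨hm1, by rw [h00]; norm_num⟩)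
  exact hni t (by simp only at ht; rw [ht]; norm_num)

/-! ### Part 2: arcs in open connected subsets of the strip -/

theorem clopen_induction {α : Type*} [TopologicalSpace α] {U G : Set α} (hU : IsPreconnected U)
    (hne : (U ∩ G).Nonempty) (h1 : ∀ z ∈ U, z ∈ G → G ∈ 𝓝 z) (h2 : ∀ z ∈ U, z ∉ G → Gᶜ ∈ 𝓝 z) :
    U ⊆ G := by
  have hsub : U ⊆ interior G := by
    apply hU.subset_left_of_subset_union isOpen_interior (isOpen_interior (s := Gᶜ))
    · exact disjoint_compl_right.mono interior_subset interior_subset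
    · intro z hz
      by_cases hg : z ∈ G
      · exact Or.inl (mem_interior_iff_mem_nhds.2 (h1 z hz hg))
      · exact Or.inr (mem_interior_iff_mem_nhds.2 (h2 z hz hg))
    · obtain ⟨z, hz, hg⟩ := hne
      exact ⟨z, hz, mem_interior_iff_mem_nhds.2 (h1 z hz hg)⟩
  exact hsub.trans interior_subset

/-- An injective (possibly degenerate) arc from `a` to `b` inside `S`. -/
def ArcIn (S : Set Strip) (a b : Strip) : Prop :=
  ∃ (l r : ℝ) (γ : ℝ → Strip), l ≤ r ∧ ContinuousOn γ (Set.Icc l r) ∧ Set.InjOn γ (Set.Icc l r) ∧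
    γ l = a ∧ γ r = b ∧ ∀ t ∈ Set.Icc l r, γ t ∈ S

theorem ArcIn.mono {S S' : Set Strip} {a b : Strip} (h : ArcIn S a b) (hS : S ⊆ S') :
    ArcIn S' a b := by
  obtain ⟨l, r, γ, h1, h2, h3, h4, h5, h6⟩ := h
  exact ⟨l, r, γ, h1, h2, h3, h4, h5, fun t ht => hS (h6 t ht)⟩

theorem ArcIn.refl {S : Set Strip} {a : Strip} (h : a ∈ S) : ArcIn S a a :=
  ⟨0, 0, fun _ => a, le_rfl, continuousOn_const, by
    intro x hx y hy _
    simp at hx hy; rw [hx, hy], rfl, rfl, fun _ _ => h⟩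

theorem ArcIn.trans {S : Set Strip} {a b c : Strip} (h : ArcIn S a b) (h' : ArcIn S b c) :
    ArcIn S a c := by
  obtain ⟨l, r, α, hlr, hα, hαi, hαl, hαr, hαS⟩ := h
  obtain ⟨l', r', δ, hlr', hδ, hδi, hδl, hδr, hδS⟩ := h'
  have hcl : IsClosed (δ '' Set.Icc l' r') := (isCompact_Icc.image_of_continuousOn hδ).isClosed
  let T : Set ℝ := Set.Icc l r ∩ α ⁻¹' (δ '' Set.Icc l' r')
  have hT : IsClosed T := hα.preimage_isClosed_of_isClosed isClosed_Icc hcl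
  have hTc : IsCompact T := isCompact_Icc.of_isClosed_subset hT Set.inter_subset_left
  have hTne : T.Nonempty := ⟨r, ⟨hlr, le_rfl⟩, l', ⟨le_rfl, hlr'⟩, by rw [hδl, hαr]⟩
  obtain ⟨τ, ⟨hτ, u, hu, huτ⟩, hmin⟩ := hTc.exists_isLeast hTne
  refine ⟨l, τ + (r' - u), fun t => if t ≤ τ then α t else δ (t - τ + u), by linarith [hτ.1, hu.2],
    ?_, ?_, ?_, ?_, ?_⟩
  · have hun : Set.Icc l (τ + (r' - u)) = Set.Icc l τ ∪ Set.Icc τ (τ + (r' - u)) :=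
      (Set.Icc_union_Icc_eq_Icc hτ.1 (by linarith [hu.2])).symm
    rw [hun]
    apply ContinuousOn.union_of_isClosed _ _ isClosed_Icc isClosed_Icc
    · refine (hα.mono (Set.Icc_subset_Icc_right hτ.2)).congr ?_
      intro t ht
      simp [ht.2]
    · have hd : ContinuousOn (fun t => δ (t - τ + u)) (Set.Icc τ (τ + (r' - u))) := by
        apply hδ.comp (by fun_prop)
        intro t ht
        exact ⟨by linarith [ht.1, hu.1], by linarith [ht.2]⟩
      refine hd.congr ?_
      intro t ht
      rcases ht.1.eq_or_lt with h | h
      · subst h; simp [huτ]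
      · simp [not_le.2 h]
  · have aux : ∀ t t', t ∈ Set.Icc l (τ + (r' - u)) → t' ∈ Set.Icc l (τ + (r' - u)) → t ≤ τ → τ < t' →
        α t ≠ δ (t' - τ + u) := by
      intro t t' ht ht' h1 h2 e
      have hmem : t' - τ + u ∈ Set.Icc l' r' := ⟨by linarith [hu.1], by linarith [ht'.2]⟩
      have htT : t ∈ T := ⟨⟨ht.1, h1.trans hτ.2⟩, _, hmem, e.symm⟩
      have : t = τ := le_antisymm h1 (hmin htT)
      subst this
      rw [← huτ] at e
      have := hδi hu hmem e
      linarith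
    intro t ht t' ht' e
    by_cases h1 : t ≤ τ <;> by_cases h2 : t' ≤ τ
    · simp only [h1, h2, if_true] at e
      exact hαi ⟨ht.1, h1.trans hτ.2⟩ ⟨ht'.1, h2.trans hτ.2⟩ e
    · simp only [h1, h2, if_true, if_false] at e
      exact absurd e (aux t t' ht ht' h1 (not_le.1 h2))
    · simp only [h1, h2, if_true, if_false] at e
      exact absurd e.symm (aux t' t ht' ht h2 (not_le.1 h1))
    · simp only [h1, h2, if_false] at e
      rw [not_le] at h1 h2
      have := hδi ⟨by linarith [hu.1], by linarith [ht.2]⟩ ⟨by linarith [hu.1], by linarith [ht'.2]⟩ e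
      linarith
  · simp [hτ.1, hαl]
  · by_cases h : τ + (r' - u) ≤ τ
    · have : u = r' := by linarith [hu.2]
      simp only [h, if_true]
      rw [← hδr, ← this, huτ]; congr 1; rw [this]; ring
    · simp only [h, if_false]
      rw [← hδr]; congr 1; ring
  · intro t ht
    by_cases h : t ≤ τ
    · simp only [h, if_true]; exact hαS _ ⟨ht.1, h.trans hτ.2⟩
    · simp only [h, if_false]
      rw [not_le] at h
      exact hδS _ ⟨by linarith [hu.1], by linarith [ht.2]⟩

theorem arcIn_ball {b z w : Strip} {ε : ℝ} (hz : z ∈ Metric.ball b ε) (hw : w ∈ Metric.ball b ε) :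
    ArcIn (Metric.ball b ε) z w := by
  by_cases hzw : z = w
  · subst hzw; exact ArcIn.refl hz
  have hconv : ∀ (p q c t : ℝ), |p - c| < ε → |q - c| < ε → t ∈ Set.Icc (0 : ℝ) 1 →
      |((1 - t) * p + t * q) - c| < ε := by
    intro p q c t hp hq ht
    rw [abs_lt] at *
    rcases ht with ⟨h0, h1⟩
    rcases h0.eq_or_lt with h | h
    · subst h; constructor <;> linarith
    · constructor <;> nlinarith
  have hI : ∀ t ∈ Set.Icc (0 : ℝ) 1, (1 - t) * (z.2 : ℝ) + t * (w.2 : ℝ) ∈ Set.Icc (-1 : ℝ) 1 := by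
    intro t ⟨h0, h1⟩
    have a := z.2.2; have b := w.2.2
    constructor <;> nlinarith [a.1, a.2, b.1, b.2]
  have hmb : ∀ v : Strip, v ∈ Metric.ball b ε ↔ |v.1 - b.1| < ε ∧ |(v.2 : ℝ) - b.2| < ε := by
    intro v
    rw [Metric.mem_ball, Prod.dist_eq, max_lt_iff, Real.dist_eq, Subtype.dist_eq, Real.dist_eq]
  let γ : ℝ → Strip := fun t => ((1 - t) * z.1 + t * w.1,
    Set.projIcc (-1 : ℝ) 1 (by norm_num) ((1 - t) * (z.2 : ℝ) + t * (w.2 : ℝ)))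
  have hγ2 : ∀ t ∈ Set.Icc (0 : ℝ) 1, ((γ t).2 : ℝ) = (1 - t) * (z.2 : ℝ) + t * (w.2 : ℝ) := by
    intro t ht
    simp only [γ, Set.projIcc_of_mem _ (hI t ht)]
  refine ⟨0, 1, γ, zero_le_one, ?_, ?_, ?_, ?_, ?_⟩
  · apply Continuous.continuousOn
    exact Continuous.prodMk (by fun_prop) (continuous_projIcc.comp (by fun_prop))
  · intro t ht t' ht' e
    have e1 : (1 - t) * z.1 + t * w.1 = (1 - t') * z.1 + t' * w.1 := congrArg Prod.fst e
    have e2 := congrArg (fun v : Strip => (v.2 : ℝ)) e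
    simp only [hγ2 t ht, hγ2 t' ht'] at e2
    by_contra hne
    apply hzw
    have hne' : t - t' ≠ 0 := sub_ne_zero.2 hne
    apply Prod.ext
    · apply mul_left_cancel₀ hne'; linarith
    · apply Subtype.ext; apply mul_left_cancel₀ hne'; linarith
  · apply Prod.ext <;> simp [γ]
  · apply Prod.ext <;> simp [γ]
  · intro t ht
    rw [hmb] at hz hw ⊢
    rw [hγ2 t ht]
    exact ⟨hconv _ _ _ _ hz.1 hw.1 ht, hconv _ _ _ _ hz.2 hw.2 ht⟩

theorem arcIn_of_preconnected {O : Set Strip} (hO : IsOpen O) (hc : IsPreconnected O) {a b : Strip}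
    (ha : a ∈ O) (hb : b ∈ O) : ArcIn O a b := by
  have : O ⊆ {b | ArcIn O a b} := by
    apply clopen_induction hc ⟨a, ha, ArcIn.refl ha⟩
    · intro z hz hzG
      obtain ⟨ε, hε, hball⟩ := Metric.isOpen_iff.1 hO z hz
      refine Filter.mem_of_superset (Metric.ball_mem_nhds z hε) ?_
      intro w hw
      exact ArcIn.trans hzG ((arcIn_ball (Metric.mem_ball_self hε) hw).mono hball)
    · intro z hz hzG
      obtain ⟨ε, hε, hball⟩ := Metric.isOpen_iff.1 hO z hz
      refine Filter.mem_of_superset (Metric.ball_mem_nhds z hε) ?_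
      intro w hw hwG
      exact hzG (ArcIn.trans hwG ((arcIn_ball hw (Metric.mem_ball_self hε)).mono hball))
  exact this hb

theorem exists_arcTo {O : Set Strip} (hO : IsOpen O) (hc : IsPreconnected O) {a x : Strip}
    (ha : a ∈ O) (hx : x ∉ O) {s : ℝ} (hs : s < 1) (δ : ℝ → Strip)
    (hδ : ContinuousOn δ (Set.Icc s 1)) (hδi : Set.InjOn δ (Set.Icc s 1))
    (hδO : ∀ t ∈ Set.Ico s 1, δ t ∈ O) (hδ1 : δ 1 = x) :
    ∃ γ, IsArcTo O γ x ∧ γ 0 = a := by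
  have h1 : ArcIn (insert x O) a (δ s) :=
    (arcIn_of_preconnected hO hc ha (hδO s ⟨le_rfl, hs⟩)).mono (Set.subset_insert _ _)
  have h2 : ArcIn (insert x O) (δ s) x := by
    refine ⟨s, 1, δ, hs.le, hδ, hδi, rfl, hδ1, ?_⟩
    intro t ht
    rcases ht.2.eq_or_lt with h | h
    · rw [h, hδ1]; exact Set.mem_insert _ _
    · exact Or.inr (hδO t ⟨ht.1, h⟩)
  obtain ⟨l, r, γ, hlr, hγ, hγi, hγl, hγr, hγS⟩ := h1.trans h2
  have hlt : l < r := by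
    rcases hlr.eq_or_lt with h | h
    · exfalso; apply hx; rw [← hγr, ← h, hγl]; exact ha
    · exact h
  have hm : ∀ t : unitInterval, l + t * (r - l) ∈ Set.Icc l r := by
    intro t
    have := t.2.1; have := t.2.2
    constructor <;> nlinarith
  refine ⟨fun t => γ (l + t * (r - l)), ⟨?_, ?_, ?_, ?_⟩, ?_⟩
  · exact hγ.comp_continuous (by fun_prop) hm
  · intro t t' e
    have := hγi (hm t) (hm t') e
    apply Subtype.ext
    apply mul_right_cancel₀ (sub_ne_zero.2 hlt.ne')
    linarith
  · intro t ht
    rcases hγS _ (hm t) with h | h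
    · exfalso
      apply ht
      have := hγi (hm t) ⟨hlr, le_rfl⟩ (h.trans hγr.symm)
      apply Subtype.ext
      apply mul_right_cancel₀ (sub_ne_zero.2 hlt.ne')
      simp; linarith
    · exact h
  · simp [hγr]
  · simp [hγl]

theorem box_preconnected (I J : Set ℝ) (hI : Convex ℝ I) (hJ : Convex ℝ J) :
    IsPreconnected {z : Strip | z.1 ∈ I ∧ (z.2 : ℝ) ∈ J} := by
  have hc : Continuous (fun p : ℝ × ℝ => ((p.1, Set.projIcc (-1 : ℝ) 1 (by norm_num) p.2) : Strip)) :=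
    Continuous.prodMk continuous_fst (continuous_projIcc.comp continuous_snd)
  have h1 : IsPreconnected (I ×ˢ (J ∩ Set.Icc (-1 : ℝ) 1)) :=
    (hI.prod (hJ.inter (convex_Icc _ _))).isPreconnected
  have h2 := h1.image _ hc.continuousOn
  convert h2 using 1
  ext z
  constructor
  · rintro ⟨h1, h2⟩
    exact ⟨(z.1, z.2), ⟨h1, h2, z.2.2⟩, Prod.ext rfl (Set.projIcc_val (by norm_num) z.2)⟩
  · rintro ⟨p, ⟨h1, h2, h3⟩, rfl⟩
    refine ⟨h1, ?_⟩
    simp only [Set.projIcc_of_mem _ h3]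
    exact h2

/-! ### Part 3: geometry of the region above `X̃` -/

theorem shiftPt_cont (k : ℤ) : Continuous (shiftPt k) := by
  unfold shiftPt; fun_prop

theorem pr_shiftPt (k : ℤ) (z : Strip) : pr (shiftPt k z) = pr z := by
  apply Prod.ext
  · change ((z.1 + (k : ℝ) : ℝ) : AddCircle (1 : ℝ)) = (z.1 : AddCircle (1 : ℝ))
    rw [AddCircle.coe_add]
    have : ((k : ℝ) : AddCircle (1 : ℝ)) = 0 := by
      rw [AddCircle.coe_eq_zero_iff]; exact ⟨k, by simp⟩
    rw [this, add_zero]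
  · rfl

theorem exists_shift_of_pr_eq {z w : Strip} (h : pr z = pr w) : ∃ k : ℤ, w = shiftPt k z := by
  have h1 : (z.1 : AddCircle (1 : ℝ)) = (w.1 : AddCircle (1 : ℝ)) := congrArg (fun a : Ann => a.1) h
  have h2 : z.2 = w.2 := congrArg (fun a : Ann => a.2) h
  have h3 : ((w.1 - z.1 : ℝ) : AddCircle (1 : ℝ)) = 0 := by
    rw [AddCircle.coe_sub, h1, sub_self]
  rw [AddCircle.coe_eq_zero_iff] at h3
  obtain ⟨k, hk⟩ := h3
  refine ⟨k, Prod.ext ?_ h2.symm⟩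
  simp at hk
  simp [shiftPt, hk]

theorem mem_shift_beta (η : ℝ) (k : ℤ) (z : Strip) :
    z ∈ shiftSet k (betaP η) ↔ z.1 = k ∧ η < (z.2 : ℝ) := by
  constructor
  · rintro ⟨w, ⟨h1, h2⟩, rfl⟩
    exact ⟨by simp [shiftPt, h1], h2⟩
  · rintro ⟨h1, h2⟩
    refine ⟨(0, z.2), ⟨rfl, h2⟩, Prod.ext (by simp [shiftPt, h1]) rfl⟩

theorem Up_isOpen {X Um Up : Set Ann} (hX : IsEAC X Um Up) : IsOpen Up := by
  rw [hX.hUp]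
  exact hX.compact.isClosed.isOpen_compl.connectedComponentIn

theorem Up_sub {X Um Up : Set Ann} (hX : IsEAC X Um Up) : Up ⊆ Xᶜ := by
  rw [hX.hUp]; exact connectedComponentIn_subset _ _

theorem topPt_notin {X Um Up : Set Ann} (hX : IsEAC X Um Up) : topPt ∈ Xᶜ := by
  intro h
  have := (hX.inInterior _ h).2
  simp [topPt] at this

theorem Up_of_preconnected {X Um Up : Set Ann} (hX : IsEAC X Um Up) {S : Set Ann}
    (hS : IsPreconnected S) (hSX : S ⊆ Xᶜ) (h0 : (S ∩ Up).Nonempty) : S ⊆ Up := by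
  obtain ⟨p, hp, hpU⟩ := h0
  rw [hX.hUp] at hpU ⊢
  rw [connectedComponentIn_eq hpU]
  exact hS.subset_connectedComponentIn hp hSX

theorem topPt_mem_Up {X Um Up : Set Ann} (hX : IsEAC X Um Up) : topPt ∈ Up := by
  rw [hX.hUp]; exact mem_connectedComponentIn (topPt_notin hX)

/-- A box in the cover, missing `X̃` and meeting the top point, lies in `Ũ₊`. -/
theorem lift_Up_of_preconnected {X Um Up : Set Ann} (hX : IsEAC X Um Up) {S : Set Strip}
    (hS : IsPreconnected S) (hSX : ∀ z ∈ S, pr z ∉ X) (h0 : (S ∩ pr ⁻¹' Up).Nonempty) :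
    S ⊆ pr ⁻¹' Up := by
  have := Up_of_preconnected hX (hS.image pr pr_cont.continuousOn)
    (by rintro _ ⟨z, hz, rfl⟩; exact hSX z hz)
    (by obtain ⟨z, hz, hzU⟩ := h0; exact ⟨pr z, ⟨z, hz, rfl⟩, hzU⟩)
  intro z hz; exact this ⟨z, hz, rfl⟩

theorem top_mem {X Um Up : Set Ann} (hX : IsEAC X Um Up) (z : Strip) (hz : (z.2 : ℝ) = 1) :
    pr z ∈ Up := by
  have h := box_preconnected Set.univ {1} convex_univ (convex_singleton 1)
  refine lift_Up_of_preconnected hX h ?_ ?_ (show z ∈ _ from ⟨trivial, hz⟩)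
  · rintro w ⟨-, hw⟩ hwX
    have := (hX.inInterior _ hwX).2
    simp [pr] at this hw
    linarith
  · refine ⟨(0, ⟨1, by norm_num, le_rfl⟩), ⟨trivial, rfl⟩, topPt_mem_Up hX⟩

theorem Ut_isOpen {X Um Up : Set Ann} (hX : IsEAC X Um Up) : IsOpen (pr ⁻¹' Up) :=
  (Up_isOpen hX).preimage pr_cont

theorem Ut_preconnected {X Um Up : Set Ann} (hX : IsEAC X Um Up) : IsPreconnected (pr ⁻¹' Up) := by
  let z0 : Strip := (0, ⟨1, by norm_num, le_rfl⟩)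
  have hz0 : z0 ∈ pr ⁻¹' Up := topPt_mem_Up hX
  set C := connectedComponentIn (pr ⁻¹' Up) z0 with hC
  have hCo : IsOpen C := (Ut_isOpen hX).connectedComponentIn
  have htop : ∀ z : Strip, (z.2 : ℝ) = 1 → z ∈ C := by
    intro z hz
    have h := box_preconnected Set.univ {1} convex_univ (convex_singleton 1)
    refine h.subset_connectedComponentIn (x := z0) ⟨trivial, rfl⟩ ?_ ⟨trivial, hz⟩
    rintro w ⟨-, hw⟩
    exact top_mem hX w hw
  have hshift : ∀ k z, z ∈ C → shiftPt k z ∈ C := by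
    intro k z hz
    have h1 : IsPreconnected (shiftPt k '' C) :=
      isPreconnected_connectedComponentIn.image _ (shiftPt_cont k).continuousOn
    have h2 : shiftPt k '' C ⊆ pr ⁻¹' Up := by
      rintro _ ⟨w, hw, rfl⟩
      change pr (shiftPt k w) ∈ Up
      rw [pr_shiftPt]
      exact connectedComponentIn_subset (pr ⁻¹' Up) z0 hw
    have h3 : shiftPt k z0 ∈ C := htop _ rfl
    have h4 := h1.subset_connectedComponentIn (x := shiftPt k z0)
      ⟨z0, mem_connectedComponentIn hz0, rfl⟩ h2
    rw [← connectedComponentIn_eq h3] at h4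
    exact h4 ⟨z, hz, rfl⟩
  have hsub : Up ⊆ pr '' C := by
    apply clopen_induction (by rw [hX.hUp]; exact isPreconnected_connectedComponentIn)
    · exact ⟨topPt, topPt_mem_Up hX, z0, mem_connectedComponentIn hz0, rfl⟩
    · rintro _ _ ⟨z, hz, rfl⟩
      exact pr_isOpenQuotientMap.isOpenMap.image_mem_nhds (hCo.mem_nhds hz)
    · intro p hp hpC
      obtain ⟨z, rfl⟩ := pr_isOpenQuotientMap.surjective p
      have hD : IsOpen (connectedComponentIn (pr ⁻¹' Up) z) := (Ut_isOpen hX).connectedComponentIn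
      have := pr_isOpenQuotientMap.isOpenMap.image_mem_nhds
        (hD.mem_nhds (mem_connectedComponentIn (show z ∈ pr ⁻¹' Up from hp)))
      refine Filter.mem_of_superset this ?_
      rintro _ ⟨w, hw, rfl⟩ ⟨v, hv, hvw⟩
      obtain ⟨k, rfl⟩ := exists_shift_of_pr_eq hvw
      have hwC := hshift k v hv
      apply hpC
      refine ⟨z, ?_, rfl⟩
      have e1 := connectedComponentIn_eq hw
      have e2 := connectedComponentIn_eq hwC
      rw [hC, e2, ← e1]
      exact mem_connectedComponentIn hp
  have : pr ⁻¹' Up ⊆ C := by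
    intro z hz
    obtain ⟨w, hw, e⟩ := hsub hz
    obtain ⟨k, rfl⟩ := exists_shift_of_pr_eq e
    exact hshift k w hw
  have e : pr ⁻¹' Up = C := Set.Subset.antisymm this (connectedComponentIn_subset _ _)
  rw [e]; exact isPreconnected_connectedComponentIn

section regions

variable {X Um Up : Set Ann} {η : ℝ}

theorem eta_facts (hX : IsEAC X Um Up) (hη : etaSpec (pr ⁻¹' X) η) :
    ∃ h : η ∈ II, η < 1 ∧ pr (0, ⟨η, h⟩) ∈ X := by
  obtain ⟨z, hz, h1, h2⟩ := hη.1
  have hzz : z = (0, ⟨η, h2 ▸ z.2.2⟩) := Prod.ext h1 (Subtype.ext h2)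
  refine ⟨h2 ▸ z.2.2, ?_, ?_⟩
  · have := (hX.inInterior _ hz).2
    simp only [pr] at this
    linarith
  · rw [← hzz]; exact hz

theorem eta_max (hη : etaSpec (pr ⁻¹' X) η) (z : Strip) (hz : pr z ∈ X) (k : ℤ)
    (hk : z.1 = k) : (z.2 : ℝ) ≤ η := by
  apply hη.2
  refine ⟨shiftPt (-k) z, ?_, ?_, rfl⟩
  · change pr _ ∈ X
    rw [pr_shiftPt]; exact hz
  · simp [shiftPt, hk]

/-- Points strictly above height `η` on integer verticals lie in `Ũ₊`. -/
theorem beta_sub (hX : IsEAC X Um Up) (hη : etaSpec (pr ⁻¹' X) η) (z : Strip) (k : ℤ)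
    (hk : z.1 = k) (hz : η < (z.2 : ℝ)) : pr z ∈ Up := by
  have h := box_preconnected {(k : ℝ)} (Set.Ioi η) (convex_singleton _) (convex_Ioi _)
  refine lift_Up_of_preconnected hX h ?_ ?_ (show z ∈ _ from ⟨hk, hz⟩)
  · rintro w ⟨hw1, hw2⟩ hwX
    exact absurd (eta_max hη w hwX k hw1) (not_le.2 hw2)
  · obtain ⟨_, h1, -⟩ := eta_facts hX hη
    exact ⟨(k, ⟨1, by norm_num, le_rfl⟩), ⟨rfl, h1⟩, top_mem hX _ rfl⟩

/-- The `k`-th translate of the open fundamental region. -/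
def Oreg (Up : Set Ann) (η : ℝ) (k : ℤ) : Set Strip :=
  connectedComponentIn (pr ⁻¹' Up \ (shiftSet k (betaP η) ∪ shiftSet (k + 1) (betaP η)))
    (shiftPt k topSeg)

theorem beta_closed_trick (hX : IsEAC X Um Up) (hη : etaSpec (pr ⁻¹' X) η) (z : Strip)
    (hz : pr z ∈ Up) (k : ℤ) : z ∈ shiftSet k (betaP η) ↔ z.1 = k ∧ η ≤ (z.2 : ℝ) := by
  rw [mem_shift_beta]
  refine and_congr_right fun hk => ⟨le_of_lt, fun h => ?_⟩
  rcases h.eq_or_lt with h | h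
  · exfalso
    obtain ⟨hI, _, h0⟩ := eta_facts hX hη
    have : z = shiftPt k (0, ⟨η, hI⟩) :=
      Prod.ext (by simp [shiftPt, hk]) (Subtype.ext h.symm)
    apply Up_sub hX hz
    rw [this, pr_shiftPt]; exact h0
  · exact h

theorem Obase_isOpen (hX : IsEAC X Um Up) (hη : etaSpec (pr ⁻¹' X) η) (k : ℤ) :
    IsOpen (pr ⁻¹' Up \ (shiftSet k (betaP η) ∪ shiftSet (k + 1) (betaP η))) := by
  have hcl : ∀ k : ℤ, IsClosed {z : Strip | z.1 = k ∧ η ≤ (z.2 : ℝ)} := fun k =>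
    (isClosed_eq continuous_fst continuous_const).inter
      (isClosed_le continuous_const (continuous_subtype_val.comp continuous_snd))
  have : pr ⁻¹' Up \ (shiftSet k (betaP η) ∪ shiftSet (k + 1) (betaP η)) =
      pr ⁻¹' Up \ ({z : Strip | z.1 = k ∧ η ≤ (z.2 : ℝ)} ∪
        {z : Strip | z.1 = (k + 1 : ℤ) ∧ η ≤ (z.2 : ℝ)}) := by
    ext z
    simp only [Set.mem_diff, Set.mem_union]
    refine and_congr_right fun hz => ?_
    rw [beta_closed_trick hX hη z hz, beta_closed_trick hX hη z hz]; rfl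
  rw [this]
  exact (Ut_isOpen hX).sdiff ((hcl k).union (hcl (k + 1)))

theorem Oreg_isOpen (hX : IsEAC X Um Up) (hη : etaSpec (pr ⁻¹' X) η) (k : ℤ) :
    IsOpen (Oreg Up η k) := (Obase_isOpen hX hη k).connectedComponentIn

theorem Oreg_preconnected (k : ℤ) : IsPreconnected (Oreg Up η k) :=
  isPreconnected_connectedComponentIn

/-- The open top segment `(k, k+1) × {1}` is contained in the `k`-th region. -/
theorem topseg_sub (hX : IsEAC X Um Up) (k : ℤ) (z : Strip) (h1 : (k : ℝ) < z.1)
    (h2 : z.1 < k + 1) (h3 : (z.2 : ℝ) = 1) : z ∈ Oreg Up η k := by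
  have h := box_preconnected (Set.Ioo (k : ℝ) (k + 1)) {1} (convex_Ioo _ _) (convex_singleton 1)
  refine h.subset_connectedComponentIn (x := shiftPt k topSeg) ?_ ?_ ⟨⟨h1, h2⟩, h3⟩
  · refine ⟨⟨?_, ?_⟩, rfl⟩ <;> simp only [shiftPt, topSeg] <;> linarith
  · rintro w ⟨⟨hw1, hw2⟩, hw3⟩
    refine ⟨top_mem hX w hw3, ?_⟩
    rintro (hw | hw) <;> rw [mem_shift_beta] at hw
    · linarith [hw.1]
    · have := hw.1; push_cast at this; linarith

theorem Oreg_absorb (k : ℤ) {S : Set Strip} (hS : IsPreconnected S)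
    (hsub : S ⊆ pr ⁻¹' Up \ (shiftSet k (betaP η) ∪ shiftSet (k + 1) (betaP η)))
    (hne : (S ∩ Oreg Up η k).Nonempty) : S ⊆ Oreg Up η k := by
  obtain ⟨p, hp, hpO⟩ := hne
  unfold Oreg at hpO ⊢
  rw [connectedComponentIn_eq hpO]
  exact hS.subset_connectedComponentIn hp hsub

theorem box_sub_Oreg (hX : IsEAC X Um Up) (k : ℤ) (a b c : ℝ) (hab : a < b) (ha : (k : ℝ) ≤ a)
    (hb : b ≤ k + 1) (hc : c < 1)
    (hU : ∀ z : Strip, a < z.1 → z.1 < b → c < (z.2 : ℝ) → pr z ∈ Up) (z : Strip)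
    (h1 : a < z.1) (h2 : z.1 < b) (h3 : c < (z.2 : ℝ)) : z ∈ Oreg Up η k := by
  have h := box_preconnected (Set.Ioo a b) (Set.Ioi c) (convex_Ioo _ _) (convex_Ioi _)
  refine Oreg_absorb k h ?_ ?_ (show z ∈ _ from ⟨⟨h1, h2⟩, h3⟩)
  · rintro w ⟨⟨hw1, hw2⟩, hw3⟩
    refine ⟨hU w hw1 hw2 hw3, ?_⟩
    rintro (hw | hw) <;> rw [mem_shift_beta] at hw
    · linarith [hw.1]
    · have := hw.1; push_cast at this; linarith
  · refine ⟨((a + b) / 2, ⟨1, by norm_num, le_rfl⟩), ⟨⟨?_, ?_⟩, hc⟩, topseg_sub hX k _ ?_ ?_ rfl⟩ <;>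
      simp only <;> linarith

theorem near_beta (hX : IsEAC X Um Up) (hη : etaSpec (pr ⁻¹' X) η) (w : Strip) (j : ℤ)
    (hw1 : w.1 = j) (hw2 : η < (w.2 : ℝ)) :
    ∃ ε > 0, ε ≤ 1 ∧ η ≤ (w.2 : ℝ) - ε ∧ ∀ z : Strip, (j : ℝ) - ε < z.1 → z.1 < j + ε →
      (w.2 : ℝ) - ε < (z.2 : ℝ) → pr z ∈ Up := by
  let K : Set Strip := {(j : ℝ)} ×ˢ (Set.Ici w.2)
  have hK : IsCompact K := isCompact_singleton.prod isClosed_Ici.isCompact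
  have hKU : K ⊆ pr ⁻¹' Up := by
    rintro z ⟨h1, h2⟩
    exact beta_sub hX hη z j h1 (lt_of_lt_of_le hw2 h2)
  obtain ⟨δ, hδ, hsub⟩ := hK.exists_thickening_subset_open (Ut_isOpen hX) hKU
  refine ⟨min δ (min 1 (w.2 - η)), ?_, ?_, ?_, ?_⟩
  · exact lt_min hδ (lt_min one_pos (sub_pos.2 hw2))
  · exact (min_le_right _ _).trans (min_le_left _ _)
  · have := (min_le_right δ (min 1 ((w.2 : ℝ) - η))).trans (min_le_right _ _); linarith
  · intro z h1 h2 h3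
    have hle := min_le_left δ (min 1 ((w.2 : ℝ) - η))
    apply hsub
    rw [Metric.mem_thickening_iff]
    refine ⟨((j : ℝ), max w.2 z.2), ⟨rfl, le_max_left w.2 z.2⟩, ?_⟩
    rw [Prod.dist_eq, max_lt_iff]
    constructor
    · rw [Real.dist_eq, abs_lt]; constructor <;> simp only <;> linarith
    · rcases le_total w.2 z.2 with h | h
      · simp only [max_eq_right h, dist_self]; exact hδ
      · simp only [max_eq_left h]
        rw [Subtype.dist_eq, Real.dist_eq, abs_lt]
        have : (z.2 : ℝ) ≤ w.2 := h
        constructor <;> linarith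

/-- Integer verticals at height at least `η`. -/
def Zset (η : ℝ) : Set Strip := {z | z.1 ∈ Set.range (fun n : ℤ => (n : ℝ)) ∧ η ≤ (z.2 : ℝ)}

theorem Zset_closed (η : ℝ) : IsClosed (Zset η) :=
  (Int.isClosedEmbedding_coe_real.isClosed_range.preimage continuous_fst).inter
    (isClosed_le continuous_const (continuous_subtype_val.comp continuous_snd))

theorem cover_regions (hX : IsEAC X Um Up) (hη : etaSpec (pr ⁻¹' X) η) (z : Strip)
    (hz : pr z ∈ Up) : (∃ k, z ∈ Oreg Up η k) ∨ ∃ j, z ∈ shiftSet j (betaP η) := by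
  suffices h : pr ⁻¹' Up ⊆ {z | (∃ k, z ∈ Oreg Up η k) ∨ ∃ j, z ∈ shiftSet j (betaP η)} from h hz
  apply clopen_induction (Ut_preconnected hX)
  · refine ⟨topSeg, top_mem hX _ rfl, Or.inl ⟨0, topseg_sub hX 0 _ ?_ ?_ rfl⟩⟩ <;>
      norm_num [topSeg]
  · rintro w hw (⟨k, hk⟩ | ⟨j, hj⟩)
    · refine Filter.mem_of_superset ((Oreg_isOpen hX hη k).mem_nhds hk) ?_
      intro v hv; exact Or.inl ⟨k, hv⟩
    · rw [mem_shift_beta] at hj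
      obtain ⟨ε, hε, hε1, hεη, hbox⟩ := near_beta hX hη w j hj.1 hj.2
      have ho : IsOpen {z : Strip | ((j : ℝ) - ε < z.1 ∧ z.1 < j + ε) ∧ (w.2 : ℝ) - ε < (z.2 : ℝ)} :=
        ((isOpen_lt continuous_const continuous_fst).inter
          (isOpen_lt continuous_fst continuous_const)).inter
          (isOpen_lt continuous_const (continuous_subtype_val.comp continuous_snd))
      refine Filter.mem_of_superset (ho.mem_nhds ⟨⟨?_, ?_⟩, ?_⟩) ?_
      · rw [hj.1]; linarith
      · rw [hj.1]; linarith
      · linarith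
      rintro v ⟨⟨h1, h2⟩, h3⟩
      have hc1 : (w.2 : ℝ) - ε < 1 := by have := w.2.2.2; linarith
      rcases lt_trichotomy v.1 (j : ℝ) with h | h | h
      · refine Or.inl ⟨j - 1, box_sub_Oreg hX (j - 1) (j - ε) j (w.2 - ε) (by linarith) ?_ ?_ hc1
          (fun z a b c => hbox z a (by linarith) c) v h1 h h3⟩ <;> push_cast <;> linarith
      · refine Or.inr ⟨j, ?_⟩
        rw [mem_shift_beta]
        exact ⟨h, by linarith⟩
      · exact Or.inl ⟨j, box_sub_Oreg hX j j (j + ε) (w.2 - ε) (by linarith) le_rfl (by linarith) hc1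
          (fun z a b c => hbox z (by linarith) b c) v h h2 h3⟩
  · intro w hw hwG
    have hwZ : w ∉ Zset η := by
      rintro ⟨⟨j, hj⟩, h2⟩
      exact hwG (Or.inr ⟨j, (beta_closed_trick hX hη w hw j).2 ⟨hj.symm, h2⟩⟩)
    have hopen : IsOpen (pr ⁻¹' Up \ Zset η) := (Ut_isOpen hX).sdiff (Zset_closed η)
    set N := connectedComponentIn (pr ⁻¹' Up \ Zset η) w with hN
    have hwN : w ∈ N := mem_connectedComponentIn ⟨hw, hwZ⟩
    have hNo : IsOpen N := hopen.connectedComponentIn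
    have hNs : N ⊆ pr ⁻¹' Up \ Zset η := connectedComponentIn_subset _ _
    have hnot : ∀ v ∈ N, ∀ j : ℤ, v ∉ shiftSet j (betaP η) := by
      intro v hv j hj
      rw [mem_shift_beta] at hj
      exact (hNs hv).2 ⟨⟨j, hj.1.symm⟩, hj.2.le⟩
    refine Filter.mem_of_superset (hNo.mem_nhds hwN) ?_
    rintro v hv (⟨k, hk⟩ | ⟨j, hj⟩)
    · apply hwG
      refine Or.inl ⟨k, Oreg_absorb k isPreconnected_connectedComponentIn ?_ ⟨v, hv, hk⟩ hwN⟩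
      intro u hu
      exact ⟨(hNs hu).1, fun h => h.elim (hnot u hu k) (hnot u hu (k + 1))⟩
    · exact hnot v hv j hj

theorem Oreg_bound (M : ℝ) (hX : IsEAC X Um Up)
    (hM : ∀ z ∈ Vset (pr ⁻¹' Up) η, z.1 ≤ M) (k : ℤ) (z : Strip)
    (hz : z ∈ Oreg Up η k) : z.1 ≤ M + k := by
  have hsh : shiftSet 0 (betaP η) = betaP η := by
    ext w; rw [mem_shift_beta]; simp [betaP]
  have h1 : IsPreconnected (shiftPt (-k) '' Oreg Up η k) :=
    (Oreg_preconnected k).image _ (shiftPt_cont _).continuousOn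
  have hsub : shiftPt (-k) '' Oreg Up η k ⊆ pr ⁻¹' Up \ (betaP η ∪ shiftSet 1 (betaP η)) := by
    rintro _ ⟨w, hw, rfl⟩
    obtain ⟨hw1, hw2⟩ := connectedComponentIn_subset _ _ hw
    refine ⟨by change pr _ ∈ Up; rw [pr_shiftPt]; exact hw1, ?_⟩
    intro h
    apply hw2
    rcases h with h | h
    · rw [← hsh, mem_shift_beta] at h
      left; rw [mem_shift_beta]
      refine ⟨?_, h.2⟩
      have := h.1; simp [shiftPt] at this; linarith
    · rw [mem_shift_beta] at h
      right; rw [mem_shift_beta]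
      refine ⟨?_, h.2⟩
      have := h.1; simp [shiftPt] at this; push_cast; linarith
  have htop : topSeg ∈ shiftPt (-k) '' Oreg Up η k := by
    refine ⟨shiftPt k topSeg, topseg_sub hX k _ ?_ ?_ rfl, ?_⟩
    · simp only [shiftPt, topSeg]; linarith
    · simp only [shiftPt, topSeg]; linarith
    · apply Prod.ext <;> simp [shiftPt]
  have h2 := h1.subset_connectedComponentIn htop hsub
  have h3 : shiftPt (-k) z ∈ Vset (pr ⁻¹' Up) η :=
    ⟨(hsub ⟨z, hz, rfl⟩).1, subset_closure (h2 ⟨z, hz, rfl⟩)⟩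
  have := hM _ h3
  simp [shiftPt] at this
  linarith

/-- The vertical arc `β + j`. -/
theorem beta_arc (hX : IsEAC X Um Up) (hη : etaSpec (pr ⁻¹' X) η) (hI : η ∈ II) (j : ℤ) :
    ∃ γ : unitInterval → Strip, IsArcTo (pr ⁻¹' Up) γ (shiftPt j (0, ⟨η, hI⟩)) ∧
      γ 0 = ((j : ℝ), ⟨1, by norm_num, le_rfl⟩) ∧ (∀ t, (γ t).1 = j) ∧ ∀ t, η ≤ ((γ t).2 : ℝ) := by
  obtain ⟨-, h1, -⟩ := eta_facts hX hη
  have hmem : ∀ t : unitInterval, 1 - (t : ℝ) * (1 - η) ∈ II := by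
    intro t
    have := t.2.1; have := t.2.2; have := hI.1
    constructor <;> nlinarith
  refine ⟨fun t => ((j : ℝ), ⟨1 - (t : ℝ) * (1 - η), hmem t⟩), ⟨?_, ?_, ?_, ?_⟩, ?_, ?_, ?_⟩
  · exact Continuous.prodMk continuous_const (Continuous.subtype_mk (by fun_prop) _)
  · intro t t' e
    have e2 := congrArg (fun z : Strip => (z.2 : ℝ)) e
    simp only at e2
    apply Subtype.ext
    apply mul_right_cancel₀ (sub_ne_zero.2 h1.ne')
    linarith
  · intro t ht
    apply beta_sub hX hη _ j rfl
    have : (t : ℝ) < 1 := lt_of_le_of_ne t.2.2 (fun h => ht (Subtype.ext h))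
    simp only; nlinarith
  · apply Prod.ext
    · simp [shiftPt]
    · apply Subtype.ext; simp [shiftPt]
  · apply Prod.ext
    · rfl
    · apply Subtype.ext; simp
  · intro t; rfl
  · intro t
    have := t.2.1; have := t.2.2
    simp only; nlinarith

/-- The key step: an accessible point of `X̃` has an index bounded below. -/
theorem exists_index (hX : IsEAC X Um Up) (hη : etaSpec (pr ⁻¹' X) η) (hI : η ∈ II) (M : ℝ)
    (hM : ∀ z ∈ Vset (pr ⁻¹' Up) η, z.1 ≤ M) (x : Strip) (hx : pr x ∈ X)
    (hacc : AccFrom (pr ⁻¹' Up) x) :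
    ∃ k : ℤ, AccIdxB 1 (pr ⁻¹' Up) x (0, ⟨η, hI⟩) k ∧ x.1 - |M| ≤ k := by
  have hxU : x ∉ pr ⁻¹' Up := fun h => Up_sub hX h hx
  by_cases hcase : ∃ j : ℤ, x = shiftPt j (0, ⟨η, hI⟩)
  · obtain ⟨j, rfl⟩ := hcase
    refine ⟨j, ⟨Or.inl rfl, ?_⟩, ?_⟩
    · obtain ⟨γ, h1, h2, h3, -⟩ := beta_arc hX hη hI j
      obtain ⟨γ', h1', h2', h3', -⟩ := beta_arc hX hη hI (j + 1)
      refine ⟨γ, γ', h1, h1', by rw [h2], by rw [h2'], ?_, by rw [h2, h2']; simp⟩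
      rw [Set.disjoint_left]
      rintro _ ⟨t, rfl⟩ ⟨t', e⟩
      have := congrArg Prod.fst e
      rw [h3, h3'] at this
      push_cast at this; linarith
    · simp only [shiftPt]; linarith [abs_nonneg M]
  · obtain ⟨δ, hδc, hδi, hδU, hδ1⟩ := hacc
    have hxZ : x ∉ Zset η := by
      rintro ⟨⟨j, hj⟩, h2⟩
      apply hcase
      refine ⟨j, Prod.ext ?_ (Subtype.ext ?_)⟩
      · simp only [shiftPt, zero_add]; exact hj.symm
      · exact le_antisymm (eta_max hη x hx j hj.symm) h2
    let δ' : ℝ → Strip := fun t => δ (Set.projIcc (0 : ℝ) 1 zero_le_one t)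
    have hδ'c : Continuous δ' := hδc.comp continuous_projIcc
    have hδ'1 : δ' 1 = x := by
      simp only [δ', Set.projIcc_right]; exact hδ1
    have hδ'i : Set.InjOn δ' (Set.Icc 0 1) := by
      intro t ht t' ht' e
      have := hδi e
      rw [Set.projIcc_of_mem _ ht, Set.projIcc_of_mem _ ht'] at this
      exact congrArg Subtype.val this
    have hδ'U : ∀ t ∈ Set.Ico (0 : ℝ) 1, δ' t ∈ pr ⁻¹' Up := by
      intro t ht
      apply hδU
      rw [Set.projIcc_of_mem _ ⟨ht.1, ht.2.le⟩]
      intro h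
      exact ht.2.ne (congrArg Subtype.val h)
    have hnear : δ' ⁻¹' (Zset η)ᶜ ∈ 𝓝 (1 : ℝ) :=
      hδ'c.continuousAt.preimage_mem_nhds ((Zset_closed η).isOpen_compl.mem_nhds (by rw [hδ'1]; exact hxZ))
    obtain ⟨ε, hε, hball⟩ := Metric.mem_nhds_iff.1 hnear
    obtain ⟨s, hs0, hs1, hsε⟩ : ∃ s : ℝ, 0 ≤ s ∧ s < 1 ∧ 1 - ε < s := by
      refine ⟨max 0 (1 - ε / 2), le_max_left _ _, max_lt one_pos (by linarith), ?_⟩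
      exact lt_of_lt_of_le (by linarith) (le_max_right _ _)
    have htZ : ∀ t ∈ Set.Ico s 1, δ' t ∉ Zset η := by
      intro t ht
      apply hball
      rw [Metric.mem_ball, Real.dist_eq, abs_lt]
      constructor <;> linarith [ht.1, ht.2]
    have htB : ∀ t ∈ Set.Ico s 1, ∀ j : ℤ, δ' t ∉ shiftSet j (betaP η) := by
      intro t ht j hj
      rw [mem_shift_beta] at hj
      exact htZ t ht ⟨⟨j, hj.1.symm⟩, hj.2.le⟩
    have htU : ∀ t ∈ Set.Ico s 1, δ' t ∈ pr ⁻¹' Up := fun t ht => hδ'U t ⟨hs0.trans ht.1, ht.2⟩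
    have hss : s ∈ Set.Ico s 1 := ⟨le_rfl, hs1⟩
    obtain ⟨k, hk⟩ : ∃ k, δ' s ∈ Oreg Up η k := by
      rcases cover_regions hX hη (δ' s) (htU s hss) with h | ⟨j, hj⟩
      · exact h
      · exact absurd hj (htB s hss j)
    have htail : δ' '' Set.Ico s 1 ⊆ Oreg Up η k := by
      apply Oreg_absorb k (isPreconnected_Ico.image _ hδ'c.continuousOn)
      · rintro _ ⟨t, ht, rfl⟩
        exact ⟨htU t ht, fun h => h.elim (htB t ht k) (htB t ht (k + 1))⟩
      · exact ⟨δ' s, ⟨s, hss, rfl⟩, hk⟩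
    have hOsub : Oreg Up η k ⊆ pr ⁻¹' Up \ (shiftSet k (betaP η) ∪ shiftSet (k + 1) (betaP η)) :=
      connectedComponentIn_subset _ _
    have htopO : shiftPt k topSeg ∈ Oreg Up η k := by
      apply topseg_sub hX k _ _ _ rfl <;> simp only [shiftPt, topSeg] <;> linarith
    obtain ⟨γ, hγ, hγ0⟩ := exists_arcTo (Oreg_isOpen hX hη k) (Oreg_preconnected k) htopO
      (fun h => hxU (hOsub h).1) hs1 δ' hδ'c.continuousOn
      (hδ'i.mono (Set.Icc_subset_Icc_left hs0))
      (fun t ht => htail ⟨t, ht, rfl⟩) hδ'1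
    have hγU : IsArcTo (pr ⁻¹' Up) γ x :=
      ⟨hγ.1, hγ.2.1, fun t ht => (hOsub (hγ.2.2.1 t ht)).1, hγ.2.2.2⟩
    have hdisj : ∀ (t : unitInterval) (z : Strip), γ t = z → η ≤ (z.2 : ℝ) →
        (z.1 = k ∨ z.1 = (k + 1 : ℤ)) → False := by
      rintro t z rfl h2 h1
      by_cases ht : t = 1
      · subst ht
        rw [hγ.2.2.2] at h1 h2
        rcases h1 with h1 | h1
        · exact hxZ ⟨⟨k, h1.symm⟩, h2⟩
        · exact hxZ ⟨⟨k + 1, h1.symm⟩, h2⟩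
      · have hO := hOsub (hγ.2.2.1 t ht)
        apply hO.2
        rcases h1 with h1 | h1
        · left; exact (beta_closed_trick hX hη _ hO.1 _).2 ⟨h1, h2⟩
        · right; exact (beta_closed_trick hX hη _ hO.1 _).2 ⟨h1, h2⟩
    have hγ01 : ((γ 0).2 : ℝ) = 1 := by rw [hγ0]; rfl
    refine ⟨k, ⟨Or.inr ?_, ?_⟩, ?_⟩
    · obtain ⟨b, h1, h2, h3, h4⟩ := beta_arc hX hη hI k
      refine ⟨b, γ, h1, hγU, by rw [h2], hγ01, ?_, ?_⟩
      · rw [Set.disjoint_left]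
        rintro _ ⟨t, rfl⟩ ⟨t', e⟩
        exact hdisj t' _ e (h4 t) (Or.inl (h3 t))
      · rw [h2, hγ0]; simp only [shiftPt, topSeg]; linarith
    · obtain ⟨b, h1, h2, h3, h4⟩ := beta_arc hX hη hI (k + 1)
      refine ⟨γ, b, hγU, h1, hγ01, by rw [h2], ?_, ?_⟩
      · rw [Set.disjoint_left]
        rintro _ ⟨t', e⟩ ⟨t, rfl⟩
        exact hdisj t' _ e (h4 t) (Or.inr (h3 t))
      · rw [h2, hγ0]; simp only [shiftPt, topSeg]; push_cast; linarith
    · have hxcl : x ∈ closure (Oreg Up η k) := by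
        have h1 : (1 : ℝ) ∈ closure (Set.Ico s 1) := by
          rw [closure_Ico hs1.ne]; exact ⟨hs1.le, le_rfl⟩
        have h2 := image_closure_subset_closure_image hδ'c (s := Set.Ico s 1) ⟨1, h1, hδ'1⟩
        exact closure_mono htail h2
      have hcl : IsClosed {z : Strip | z.1 ≤ M + k} := isClosed_le continuous_fst continuous_const
      have : x.1 ≤ M + k :=
        closure_minimal (fun z hz => Oreg_bound M hX hM k z hz) hcl hxcl
      linarith [le_abs_self M]

end regions

theorem f_Up_sub (f : Ann ≃ₜ Ann) (hf : IsotopicToId ⇑f) {X Um Up : Set Ann}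
    (hX : IsEAC X Um Up) (hinv : ⇑f '' X = X) : ∀ p ∈ Up, f p ∈ Up := by
  have hpre : IsPreconnected (f '' Up) := by
    refine IsPreconnected.image ?_ _ f.continuous.continuousOn
    rw [hX.hUp]; exact isPreconnected_connectedComponentIn
  have hsub : f '' Up ⊆ Xᶜ := by
    rintro _ ⟨p, hp, rfl⟩ hpX
    rw [← hinv] at hpX
    obtain ⟨q, hq, e⟩ := hpX
    rw [f.injective e] at hq
    exact Up_sub hX hp hq
  have htop : f topPt ∈ Up := by
    obtain ⟨z, hz⟩ := pr_isOpenQuotientMap.surjective (f topPt)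
    rw [← hz]
    apply top_mem hX
    have := isotopic_top f hf
    rw [← hz] at this
    exact this
  have := Up_of_preconnected hX hpre hsub ⟨f topPt, ⟨topPt, topPt_mem_Up hX, rfl⟩, htop⟩
  intro p hp
  exact this ⟨p, hp, rfl⟩

/-- Case (ii) is impossible: under the standing contradiction hypotheses,
if `(V)₁` is unbounded from below then it is also unbounded from above. -/
theorem V_unbounded_above
    (f : Ann ≃ₜ Ann) (hf : IsotopicToId ⇑f)
    (F : Strip ≃ₜ Strip) (hF : IsLift ⇑f ⇑F)
    (X Um Up : Set Ann) (hX : IsEAC X Um Up) (hinv : ⇑f '' X = X)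
    (φ : Ann → ℝ) (hφc : Continuous φ)
    (hφ : ∀ z : Strip, φ (pr z) = (F z).1 - z.1)
    (ρ : ℝ) (hρneg : ρ < 0)
    (hrot : PrimeEndRotB 1 (pr ⁻¹' Up) (pr ⁻¹' X) ⇑F ρ)
    (hpos : 0 < sInf (rotMes ⇑f φ X))
    (hdisp : ∀ z ∈ pr ⁻¹' X, (F z).1 ≥ z.1 + 1)
    (η : ℝ) (hη : etaSpec (pr ⁻¹' X) η)
    (hbelow : ¬ BddBelow (Prod.fst '' Vset (pr ⁻¹' Up) η)) :
    ¬ BddAbove (Prod.fst '' Vset (pr ⁻¹' Up) η) := by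
  intro hab
  obtain ⟨M, hM'⟩ := hab
  have hM : ∀ z ∈ Vset (pr ⁻¹' Up) η, z.1 ≤ M := fun z hz => hM' ⟨z, hz, rfl⟩
  obtain ⟨hI, h1, hx0⟩ := eta_facts hX hη
  set x0 : Strip := (0, ⟨η, hI⟩) with hx0def
  have hU := f_Up_sub f hf hX hinv
  have hacc0 : AccFrom (pr ⁻¹' Up) x0 := by
    obtain ⟨γ, hγ, -⟩ := beta_arc hX hη hI 0
    refine ⟨γ, ?_⟩
    have : shiftPt 0 x0 = x0 := by apply Prod.ext <;> simp [shiftPt]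
    rwa [this] at hγ
  have hstep : ∀ n : ℕ, pr (F^[n] x0) ∈ X ∧ AccFrom (pr ⁻¹' Up) (F^[n] x0) ∧
      (n : ℝ) ≤ (F^[n] x0).1 := by
    intro n
    induction n with
    | zero => exact ⟨hx0, hacc0, by simp [x0]⟩
    | succ n ih =>
      obtain ⟨i1, ⟨γ, g1, g2, g3, g4⟩, i3⟩ := ih
      rw [Function.iterate_succ_apply']
      refine ⟨?_, ⟨fun t => F (γ t), F.continuous.comp g1, F.injective.comp g2, ?_, ?_⟩, ?_⟩
      · rw [hF.1, ← hinv]; exact ⟨_, i1, rfl⟩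
      · intro t ht
        change pr (F (γ t)) ∈ Up
        rw [hF.1]; exact hU _ (g3 t ht)
      · change F (γ 1) = _
        rw [g4]
      · have := hdisp _ i1
        push_cast; linarith
  choose k hk hkM using fun n => exists_index hX hη hI M hM (F^[n] x0) (hstep n).1 (hstep n).2.1
  have hlim := hrot x0 hx0 x0 hx0 hacc0 hacc0 k hk
  have hev : ∀ᶠ n : ℕ in atTop, (k n : ℝ) / n < 0 := hlim.eventually (gt_mem_nhds hρneg)
  have hev2 : ∀ᶠ n : ℕ in atTop, |M| ≤ (n : ℝ) := tendsto_natCast_atTop_atTop.eventually_ge_atTop _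
  obtain ⟨n, hn1, hn2⟩ := (hev.and hev2).exists
  have h3 : (0 : ℝ) ≤ k n := by
    have := hkM n
    have := (hstep n).2.2
    linarith
  have : (0 : ℝ) ≤ (k n : ℝ) / n := div_nonneg h3 (Nat.cast_nonneg n)
  linarith
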